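/- Let t ∈ (0,1) and consider the first-price auction instance with n = 2 bidders, B_u = {1}, B_v = {2}, m = 2 auctions, and values v 1 1 = 1, v 1 2 = v 2 1 = 0, v 2 2 = 1 − t + t·ln t. Consider the strategy profile in which bidder 1 deterministically bids b 1 1 = b 1 2 = 0, and bidder 2 bids b 2 2 = 0 and bids randomly in auction 1 with cumulative distribution function P(b 2 1 ≤ s) = min{1, t/(1 − s)} for s ∈ [0,1). Then this profile is an equilibrium, E[val 1] = t, E[val 2] = 1 − t + t·ln t, and the ratio of equilibrium welfare to optimal welfare equals (1 + t·ln t)/(2 − t + t·ln t). Consequently, the price of anarchy of the first-price auction in the mixed autobidding world is at most min over t ∈ [0,1] of (1 + t·ln t)/(2 − t + t·ln t). -/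

import Mathlib

open MeasureTheory Finset
open scoped Classical

namespace FPA

variable {n m : ℕ}

/-- Bidder `i` wins auction `j` under bid profile `b`: highest bid, ties broken
in favor of larger value, then smaller index. -/
def Wins (v b : Fin n → Fin m → ℝ) (j : Fin m) (i : Fin n) : Prop :=
  ∀ i', i' ≠ i →
    b i' j < b i j ∨ (b i' j = b i j ∧ (v i' j < v i j ∨ (v i' j = v i j ∧ i < i')))

/-- Indicator that bidder `i` wins auction `j`. -/
noncomputable def xind (v b : Fin n → Fin m → ℝ) (j : Fin m) (i : Fin n) : ℝ :=
  if Wins v b j i then 1 else 0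

noncomputable def valij (v b : Fin n → Fin m → ℝ) (i : Fin n) (j : Fin m) : ℝ :=
  xind v b j i * v i j

noncomputable def payij (v b : Fin n → Fin m → ℝ) (i : Fin n) (j : Fin m) : ℝ :=
  xind v b j i * b i j

/-- Admissible strategy: probability distribution over nonnegative bid vectors
with finite expectations. -/
def Admissible (σ : Measure (Fin m → ℝ)) : Prop :=
  IsProbabilityMeasure σ ∧ (∀ᵐ β ∂σ, ∀ j, 0 ≤ β j) ∧ ∀ j, Integrable (fun β => β j) σ

noncomputable def EValij (v : Fin n → Fin m → ℝ) (μ : Fin n → Measure (Fin m → ℝ))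
    (i : Fin n) (j : Fin m) : ℝ :=
  ∫ b, valij v b i j ∂(Measure.pi μ)

noncomputable def EPayij (v : Fin n → Fin m → ℝ) (μ : Fin n → Measure (Fin m → ℝ))
    (i : Fin n) (j : Fin m) : ℝ :=
  ∫ b, payij v b i j ∂(Measure.pi μ)

noncomputable def EVal (v : Fin n → Fin m → ℝ) (μ : Fin n → Measure (Fin m → ℝ))
    (i : Fin n) : ℝ :=
  ∑ j, EValij v μ i j

noncomputable def EPay (v : Fin n → Fin m → ℝ) (μ : Fin n → Measure (Fin m → ℝ))
    (i : Fin n) : ℝ :=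
  ∑ j, EPayij v μ i j

noncomputable def EUtil (v : Fin n → Fin m → ℝ) (μ : Fin n → Measure (Fin m → ℝ))
    (i : Fin n) : ℝ :=
  EVal v μ i - EPay v μ i

/-- A utility maximizer best responds: no admissible deviation improves expected utility. -/
def UtilBest (v : Fin n → Fin m → ℝ) (μ : Fin n → Measure (Fin m → ℝ)) (i : Fin n) : Prop :=
  ∀ σ, Admissible σ → EUtil v (Function.update μ i σ) i ≤ EUtil v μ i

/-- A value maximizer best responds: its ROI constraint holds and no admissible
deviation satisfying the ROI constraint yields more expected value. -/
def ValBest (v : Fin n → Fin m → ℝ) (μ : Fin n → Measure (Fin m → ℝ)) (i : Fin n) : Prop :=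
  EPay v μ i ≤ EVal v μ i ∧
    ∀ σ, Admissible σ →
      EPay v (Function.update μ i σ) i ≤ EVal v (Function.update μ i σ) i →
      EVal v (Function.update μ i σ) i ≤ EVal v μ i

/-- Equilibrium: all strategies admissible, every utility maximizer in `Bu` and
every value maximizer in `Bv` best responds. -/
def Equilibrium (v : Fin n → Fin m → ℝ) (Bu Bv : Finset (Fin n))
    (μ : Fin n → Measure (Fin m → ℝ)) : Prop :=
  (∀ i, Admissible (μ i)) ∧ (∀ i ∈ Bu, UtilBest v μ i) ∧ (∀ i ∈ Bv, ValBest v μ i)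

/-- The rightful winner of auction `j`: the bidder with the highest value,
ties broken toward the smaller index. -/
noncomputable def rwinner [NeZero n] (v : Fin n → Fin m → ℝ) (j : Fin m) : Fin n :=
  (Finset.univ.filter fun i => ∀ i', v i' j ≤ v i j).min' (by
    obtain ⟨i, -, hi⟩ := Finset.exists_max_image (Finset.univ : Finset (Fin n))
      (fun i => v i j) Finset.univ_nonempty
    exact ⟨i, Finset.mem_filter.mpr ⟨Finset.mem_univ _, fun i' => hi i' (Finset.mem_univ _)⟩⟩)

end FPA

open MeasureTheory Finset

/-- Values of the tight mixed instance: `v 1 1 = 1`, `v 2 2 = 1 - t + t ln t`,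
off-diagonal `0`. -/
noncomputable def tightV (t : ℝ) : Fin 2 → Fin 2 → ℝ :=
  ![![1, 0], ![0, 1 - t + t * Real.log t]]

namespace FPA

lemma tightV_pos {t : ℝ} (ht0 : 0 < t) (ht1 : t < 1) : 0 < 1 - t + t * Real.log t := by
  have h := mul_lt_mul_of_pos_left
    (Real.log_lt_sub_one_of_pos (inv_pos.2 ht0) (inv_eq_one.not.2 ht1.ne)) ht0
  rw [Real.log_inv, mul_sub, mul_inv_cancel₀ ht0.ne'] at h
  linarith

lemma wins_zero_zero (t : ℝ) (b : Fin 2 → Fin 2 → ℝ) :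
    Wins (tightV t) b 0 0 ↔ b 1 0 ≤ b 0 0 := by
  simp [Wins, Fin.forall_fin_two, tightV, le_iff_lt_or_eq]

lemma wins_zero_one (t : ℝ) (b : Fin 2 → Fin 2 → ℝ) :
    Wins (tightV t) b 0 1 ↔ b 0 0 < b 1 0 := by
  simp [Wins, Fin.forall_fin_two, tightV, not_lt.mpr (zero_le_one (α := ℝ))]

lemma wins_one_one {t : ℝ} (hw : 0 < 1 - t + t * Real.log t) (b : Fin 2 → Fin 2 → ℝ) :
    Wins (tightV t) b 1 1 ↔ b 0 1 ≤ b 1 1 := by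
  simp [Wins, Fin.forall_fin_two, tightV, le_iff_lt_or_eq, hw]

lemma tightV_zero_one (t : ℝ) : tightV t 0 1 = 0 := by simp [tightV]

lemma tightV_one_zero (t : ℝ) : tightV t 1 0 = 0 := by simp [tightV]

lemma tightV_zero_zero (t : ℝ) : tightV t 0 0 = 1 := by simp [tightV]

lemma tightV_one_one (t : ℝ) : tightV t 1 1 = 1 - t + t * Real.log t := by simp [tightV]

lemma EValij_zero_one (t : ℝ) (μ : Fin 2 → Measure (Fin 2 → ℝ)) :
    EValij (tightV t) μ 0 1 = 0 := by
  simp [EValij, valij, tightV_zero_one]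

lemma EValij_one_zero (t : ℝ) (μ : Fin 2 → Measure (Fin 2 → ℝ)) :
    EValij (tightV t) μ 1 0 = 0 := by
  simp [EValij, valij, tightV_one_zero]

lemma xind_nonneg {n m : ℕ} (v b : Fin n → Fin m → ℝ) (j : Fin m) (i : Fin n) :
    0 ≤ xind v b j i := by
  unfold xind; split_ifs <;> simp

lemma xind_le_one {n m : ℕ} (v b : Fin n → Fin m → ℝ) (j : Fin m) (i : Fin n) :
    xind v b j i ≤ 1 := by
  unfold xind; split_ifs <;> simp

lemma isProbabilityMeasure_vec {μ₀ μ₁ : Measure (Fin 2 → ℝ)} [IsProbabilityMeasure μ₀]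
    [IsProbabilityMeasure μ₁] (i : Fin 2) : IsProbabilityMeasure (![μ₀, μ₁] i) := by
  fin_cases i
  · exact ‹IsProbabilityMeasure μ₀›
  · exact ‹IsProbabilityMeasure μ₁›

lemma EVal_one_le {t : ℝ} (hw : 0 < 1 - t + t * Real.log t) {μ₀ μ₁ : Measure (Fin 2 → ℝ)}
    [IsProbabilityMeasure μ₀] [IsProbabilityMeasure μ₁] :
    EVal (tightV t) ![μ₀, μ₁] 1 ≤ 1 - t + t * Real.log t := by
  have := isProbabilityMeasure_vec (μ₀ := μ₀) (μ₁ := μ₁)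
  rw [EVal, Fin.sum_univ_two, EValij_one_zero, zero_add, EValij]
  calc ∫ b, valij (tightV t) b 1 1 ∂(Measure.pi ![μ₀, μ₁])
      ≤ ∫ _, (1 - t + t * Real.log t) ∂(Measure.pi ![μ₀, μ₁]) := by
        refine integral_mono_of_nonneg (.of_forall fun b => ?_) (integrable_const _)
          (.of_forall fun b => ?_)
        · simp only [valij, tightV_one_one]
          exact mul_nonneg (xind_nonneg _ _ _ _) hw.le
        · simp only [valij, tightV_one_one]
          exact mul_le_of_le_one_left hw.le (xind_le_one _ _ _ _)
    _ = 1 - t + t * Real.log t := by simp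

/-- If no deterministic bid `s` in the first auction earns bidder `0` more than `t`, then no
admissible strategy has expected utility above `t`. -/
lemma EUtil_zero_le {t : ℝ} {σ σ₂ : Measure (Fin 2 → ℝ)}
    (hσ : Admissible σ) [IsProbabilityMeasure σ₂]
    (hF : ∀ s, 0 ≤ s → (1 - s) * σ₂.real {γ | γ 0 ≤ s} ≤ t) :
    EUtil (tightV t) ![σ, σ₂] 0 ≤ t := by
  obtain ⟨hp, hnn, hint⟩ := hσ
  have hprob := isProbabilityMeasure_vec (μ₀ := σ) (μ₁ := σ₂)
  have mp := measurePreserving_eval (![σ, σ₂]) 0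
  have mp2 := measurePreserving_piFinTwo (![σ, σ₂])
  have hS : MeasurableSet {b : Fin 2 → Fin 2 → ℝ | b 1 0 ≤ b 0 0} :=
    measurableSet_le (by fun_prop) (by fun_prop)
  have hx : (fun b => xind (tightV t) b 0 0) =
      Set.indicator {b : Fin 2 → Fin 2 → ℝ | b 1 0 ≤ b 0 0} (fun _ => (1 : ℝ)) := by
    ext b
    simp [xind, wins_zero_zero, Set.indicator_apply]
  have hpay : (fun b => payij (tightV t) b 0 0) =
      Set.indicator {b : Fin 2 → Fin 2 → ℝ | b 1 0 ≤ b 0 0} (fun b => b 0 0) := by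
    ext b
    simp [payij, xind, wins_zero_zero, Set.indicator_apply]
  have hb : Integrable (fun b : Fin 2 → Fin 2 → ℝ => b 0 0) (Measure.pi ![σ, σ₂]) :=
    mp.integrable_comp_of_integrable (g := fun β : Fin 2 → ℝ => β 0) (hint 0)
  have hI1 : Integrable (fun b => valij (tightV t) b 0 0) (Measure.pi ![σ, σ₂]) := by
    simp only [valij, tightV_zero_zero, mul_one, hx]
    exact (integrable_const _).indicator hS
  have hI2 : Integrable (fun b => payij (tightV t) b 0 0) (Measure.pi ![σ, σ₂]) := by
    rw [hpay]
    exact hb.indicator hS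
  have hpos : 0 ≤ EPayij (tightV t) ![σ, σ₂] 0 1 := by
    refine integral_nonneg_of_ae ?_
    filter_upwards [mp.quasiMeasurePreserving.ae hnn] with b hb
    exact mul_nonneg (xind_nonneg _ _ _ _) (hb 1)
  let g : (Fin 2 → ℝ) × (Fin 2 → ℝ) → ℝ :=
    fun p => (1 - p.1 0) * {γ : Fin 2 → ℝ | γ 0 ≤ p.1 0}.indicator (fun _ => (1 : ℝ)) p.2
  have hg : (fun b => valij (tightV t) b 0 0 - payij (tightV t) b 0 0) =
      g ∘ MeasurableEquiv.piFinTwo (fun _ : Fin 2 => Fin 2 → ℝ) := by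
    ext b
    simp [valij, payij, g, xind, wins_zero_zero, tightV_zero_zero, Set.indicator_apply]
    split_ifs <;> simp
  have hgI : Integrable g (σ.prod σ₂) := by
    have h := hI1.sub hI2
    exact (mp2.integrable_comp_emb (MeasurableEquiv.measurableEmbedding _)).1 (hg ▸ h)
  have key : EValij (tightV t) ![σ, σ₂] 0 0 - EPayij (tightV t) ![σ, σ₂] 0 0 ≤ t := by
    rw [EValij, EPayij, ← integral_sub hI1 hI2, hg]
    have h1 := mp2.integral_comp (MeasurableEquiv.measurableEmbedding _) g
    refine h1.trans_le ?_
    change ∫ p, g p ∂(σ.prod σ₂) ≤ t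
    rw [integral_prod _ hgI]
    calc ∫ β, ∫ γ, g (β, γ) ∂σ₂ ∂σ ≤ ∫ _, t ∂σ := by
          refine integral_mono_ae hgI.integral_prod_left (integrable_const _) ?_
          filter_upwards [hnn] with β hβ
          have hm : MeasurableSet {γ : Fin 2 → ℝ | γ 0 ≤ β 0} :=
            measurableSet_le (by fun_prop) (by fun_prop)
          simp only [g]
          rw [integral_const_mul, integral_indicator_const _ hm, smul_eq_mul, mul_one]
          exact hF _ (hβ 0)
      _ = t := by simp
  rw [EUtil, EVal, EPay, Fin.sum_univ_two, Fin.sum_univ_two, EValij_zero_one]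
  linarith

lemma integral_one_sub_div {t : ℝ} (ht0 : 0 < t) (ht1 : t < 1) :
    ∫ s in (0 : ℝ)..(1 - t), (1 - t / (1 - s)) = 1 - t + t * Real.log t := by
  have hne : ∀ s ∈ Set.uIcc (0 : ℝ) (1 - t), 1 - s ≠ 0 := by
    intro s hs
    rw [Set.uIcc_of_le (by linarith)] at hs
    linarith [hs.2]
  rw [intervalIntegral.integral_eq_sub_of_hasDerivAt
    (f := fun s => s + t * Real.log (1 - s))]
  · simp
  · intro s hs
    refine ((hasDerivAt_id' s).add
      ((((hasDerivAt_id' s).const_sub 1).log (hne s hs)).const_mul t)).congr_deriv ?_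
    ring
  · apply ContinuousOn.intervalIntegrable
    exact continuousOn_const.sub
      (continuousOn_const.div (continuousOn_const.sub continuousOn_id) hne)

section CDF

variable {t : ℝ} {σ₂ : Measure (Fin 2 → ℝ)}

lemma cdf_eq (ht0 : 0 < t)
    (hcdf : ∀ s ∈ Set.Ico (0 : ℝ) 1,
      σ₂ {β | β 0 ≤ s} = ENNReal.ofReal (min 1 (t / (1 - s))))
    {s : ℝ} (h0 : 0 ≤ s) (h1 : s < 1) : σ₂.real {β | β 0 ≤ s} = min 1 (t / (1 - s)) := by
  have : 0 ≤ t / (1 - s) := div_nonneg ht0.le (by linarith)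
  rw [Measure.real, hcdf s ⟨h0, h1⟩, ENNReal.toReal_ofReal (le_min zero_le_one this)]

variable [IsProbabilityMeasure σ₂]

lemma cdf_eq_one (ht0 : 0 < t) (ht1 : t < 1)
    (hcdf : ∀ s ∈ Set.Ico (0 : ℝ) 1,
      σ₂ {β | β 0 ≤ s} = ENNReal.ofReal (min 1 (t / (1 - s))))
    {s : ℝ} (h : 1 - t ≤ s) : σ₂.real {β | β 0 ≤ s} = 1 := by
  refine le_antisymm measureReal_le_one ?_
  have h1 : σ₂.real {β | β 0 ≤ 1 - t} = 1 := by
    rw [cdf_eq ht0 hcdf (by linarith) (by linarith)]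
    simp [ht0.ne']
  rw [← h1]
  exact measureReal_mono fun β (hβ : β 0 ≤ 1 - t) => hβ.trans h

lemma integral_bid (ht0 : 0 < t) (ht1 : t < 1) (hadm : Admissible σ₂)
    (hcdf : ∀ s ∈ Set.Ico (0 : ℝ) 1,
      σ₂ {β | β 0 ≤ s} = ENNReal.ofReal (min 1 (t / (1 - s)))) :
    ∫ β, β 0 ∂σ₂ = 1 - t + t * Real.log t := by
  have hnn : 0 ≤ᵐ[σ₂] fun β => β 0 := by
    filter_upwards [hadm.2.1] with β hβ using hβ 0
  rw [(hadm.2.2 0).integral_eq_integral_meas_lt hnn, ← integral_one_sub_div ht0 ht1,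
    intervalIntegral.integral_of_le (by linarith),
    setIntegral_eq_of_subset_of_forall_sdiff_eq_zero measurableSet_Ioi
      (Set.Ioc_subset_Ioi_self : Set.Ioc 0 (1 - t) ⊆ Set.Ioi (0 : ℝ))]
  · refine setIntegral_congr_fun measurableSet_Ioc fun s hs => ?_
    have hs1 : 0 < 1 - s := by linarith [hs.2]
    have hm : MeasurableSet {β : Fin 2 → ℝ | β 0 ≤ s} :=
      measurableSet_le (by fun_prop) (by fun_prop)
    have hc : {β : Fin 2 → ℝ | s < β 0} = {β : Fin 2 → ℝ | β 0 ≤ s}ᶜ := by ext; simp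
    simp only [hc]
    rw [probReal_compl_eq_one_sub hm, cdf_eq ht0 hcdf hs.1.le (by linarith), min_eq_right]
    rw [div_le_one hs1]
    linarith [hs.2]
  · intro s hs
    have hs' : 1 - t ≤ s := by
      by_contra! h
      exact hs.2 ⟨hs.1, h.le⟩
    have hm : MeasurableSet {β : Fin 2 → ℝ | β 0 ≤ s} :=
      measurableSet_le (by fun_prop) (by fun_prop)
    have hc : {β : Fin 2 → ℝ | s < β 0} = {β : Fin 2 → ℝ | β 0 ≤ s}ᶜ := by ext; simp
    rw [hc, probReal_compl_eq_one_sub hm, cdf_eq_one ht0 ht1 hcdf hs', sub_self]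

lemma one_sub_mul_cdf_le (ht0 : 0 < t) (ht1 : t < 1)
    (hcdf : ∀ s ∈ Set.Ico (0 : ℝ) 1,
      σ₂ {β | β 0 ≤ s} = ENNReal.ofReal (min 1 (t / (1 - s))))
    {s : ℝ} (h0 : 0 ≤ s) : (1 - s) * σ₂.real {β | β 0 ≤ s} ≤ t := by
  rcases lt_or_ge s 1 with h1 | h1
  · rw [cdf_eq ht0 hcdf h0 h1]
    have hs : 0 < 1 - s := by linarith
    calc (1 - s) * min 1 (t / (1 - s)) ≤ (1 - s) * (t / (1 - s)) :=
          mul_le_mul_of_nonneg_left (min_le_right _ _) hs.le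
      _ = t := by field_simp
  · rw [cdf_eq_one ht0 ht1 hcdf (by linarith)]
    linarith

end CDF

section Profile

variable {t : ℝ} {σ₂ : Measure (Fin 2 → ℝ)} [IsProbabilityMeasure σ₂]

lemma ae_bid_zero : ∀ᵐ b ∂(Measure.pi ![Measure.dirac (![0, 0] : Fin 2 → ℝ), σ₂]),
    b 0 = ![0, 0] := by
  have := isProbabilityMeasure_vec (μ₀ := Measure.dirac (![0, 0] : Fin 2 → ℝ)) (μ₁ := σ₂)
  have mp := measurePreserving_eval (![Measure.dirac (![0, 0] : Fin 2 → ℝ), σ₂]) 0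
  have h : ∀ᵐ β ∂(Measure.dirac (![0, 0] : Fin 2 → ℝ)), β = ![0, 0] := by
    rw [ae_dirac_eq]; rfl
  exact mp.quasiMeasurePreserving.ae h

lemma ae_bid_one {p : (Fin 2 → ℝ) → Prop} (h : ∀ᵐ β ∂σ₂, p β) :
    ∀ᵐ b ∂(Measure.pi ![Measure.dirac (![0, 0] : Fin 2 → ℝ), σ₂]), p (b 1) := by
  have := isProbabilityMeasure_vec (μ₀ := Measure.dirac (![0, 0] : Fin 2 → ℝ)) (μ₁ := σ₂)
  exact (measurePreserving_eval (![Measure.dirac (![0, 0] : Fin 2 → ℝ), σ₂])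
    1).quasiMeasurePreserving.ae h

lemma integral_bid_one {f : (Fin 2 → ℝ) → ℝ} (hf : Measurable f) :
    ∫ b, f (b 1) ∂(Measure.pi ![Measure.dirac (![0, 0] : Fin 2 → ℝ), σ₂]) = ∫ β, f β ∂σ₂ := by
  have := isProbabilityMeasure_vec (μ₀ := Measure.dirac (![0, 0] : Fin 2 → ℝ)) (μ₁ := σ₂)
  have mp := measurePreserving_eval (![Measure.dirac (![0, 0] : Fin 2 → ℝ), σ₂]) 1
  have h := integral_map (f := f)
    (μ := Measure.pi ![Measure.dirac (![0, 0] : Fin 2 → ℝ), σ₂]) mp.measurable.aemeasurable hf.aestronglyMeasurable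
  rw [mp.map_eq] at h
  exact h.symm

lemma EVal_zero_eq :
    EVal (tightV t) ![Measure.dirac ![0, 0], σ₂] 0 = σ₂.real {β | β 0 ≤ 0} := by
  have hm : MeasurableSet {β : Fin 2 → ℝ | β 0 ≤ 0} :=
    measurableSet_le (by fun_prop) (by fun_prop)
  rw [EVal, Fin.sum_univ_two, EValij_zero_one, add_zero, EValij,
    ← integral_indicator_one hm, ← integral_bid_one (measurable_one.indicator hm)]
  refine integral_congr_ae ?_
  filter_upwards [ae_bid_zero] with b hb
  simp [valij, xind, wins_zero_zero, tightV_zero_zero, hb, Set.indicator_apply]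

lemma EPay_zero_eq : EPay (tightV t) ![Measure.dirac ![0, 0], σ₂] 0 = 0 := by
  refine Finset.sum_eq_zero fun j _ => integral_eq_zero_of_ae ?_
  filter_upwards [ae_bid_zero] with b hb
  fin_cases j <;> simp [payij, hb]

lemma EVal_one_eq (hw : 0 < 1 - t + t * Real.log t) (h1 : ∀ᵐ β ∂σ₂, β 1 = 0) :
    EVal (tightV t) ![Measure.dirac ![0, 0], σ₂] 1 = 1 - t + t * Real.log t := by
  have := isProbabilityMeasure_vec (μ₀ := Measure.dirac (![0, 0] : Fin 2 → ℝ)) (μ₁ := σ₂)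
  rw [EVal, Fin.sum_univ_two, EValij_one_zero, zero_add, EValij]
  trans ∫ _, (1 - t + t * Real.log t) ∂(Measure.pi ![Measure.dirac (![0, 0] : Fin 2 → ℝ), σ₂])
  · refine integral_congr_ae ?_
    filter_upwards [ae_bid_zero, ae_bid_one h1] with b hb hb'
    simp [valij, xind, wins_one_one hw, tightV_one_one, hb, hb']
  · simp

lemma EPay_one_eq (h0 : ∀ᵐ β ∂σ₂, 0 ≤ β 0) (h1 : ∀ᵐ β ∂σ₂, β 1 = 0) :
    EPay (tightV t) ![Measure.dirac ![0, 0], σ₂] 1 = ∫ β, β 0 ∂σ₂ := by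
  have hz : EPayij (tightV t) ![Measure.dirac ![0, 0], σ₂] 1 1 = 0 := by
    refine integral_eq_zero_of_ae ?_
    filter_upwards [ae_bid_one h1] with b hb
    simp [payij, hb]
  rw [EPay, Fin.sum_univ_two, hz, add_zero, EPayij,
    ← integral_bid_one (measurable_pi_apply (0 : Fin 2))]
  refine integral_congr_ae ?_
  filter_upwards [ae_bid_zero, ae_bid_one h0] with b hb hb'
  simp only [payij, xind, wins_zero_one, hb]
  rcases hb'.eq_or_lt with h | h
  · simp [← h]
  · simp [h]

end Profile

lemma admissible_dirac {m : ℕ} {β : Fin m → ℝ} (hβ : ∀ j, 0 ≤ β j) :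
    Admissible (Measure.dirac β) := by
  refine ⟨inferInstance, ?_, fun j => integrable_dirac (by simp)⟩
  rw [ae_dirac_eq]
  exact hβ

lemma sum_sup_tightV {t : ℝ} (hw : 0 < 1 - t + t * Real.log t) :
    (∑ j, Finset.univ.sup' Finset.univ_nonempty fun i => tightV t i j) =
      2 - t + t * Real.log t := by
  have h (f : Fin 2 → ℝ) : Finset.univ.sup' Finset.univ_nonempty f = max (f 0) (f 1) := by
    refine le_antisymm (Finset.sup'_le _ _ fun i _ => ?_)
      (max_le (Finset.le_sup' f (Finset.mem_univ 0)) (Finset.le_sup' f (Finset.mem_univ 1)))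
    fin_cases i
    · exact le_max_left _ _
    · exact le_max_right _ _
  rw [Fin.sum_univ_two, h, h, tightV_zero_zero, tightV_one_zero, tightV_zero_one,
    tightV_one_one, max_eq_left zero_le_one, max_eq_right hw.le]
  ring

end FPA

/-- Lemma 6 of the paper. For `t ∈ (0,1)`, consider the instance with
a utility maximizer (bidder `0`) and a value maximizer (bidder `1`), where bidder `0`
bids `0` in both auctions deterministically and bidder `1` bids `0` in auction `2` and
bids in auction `1` with CDF `s ↦ min {1, t/(1 - s)}` on `[0,1)`.  Then this profile is
an equilibrium, `E[val 1] = t`, `E[val 2] = 1 - t + t ln t`, and the ratio of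
equilibrium welfare to optimal welfare is `(1 + t ln t)/(2 - t + t ln t)`. -/
theorem fpa_mixed_autobidding_tight_instance (t : ℝ) (ht0 : 0 < t) (ht1 : t < 1)
    (σ₂ : Measure (Fin 2 → ℝ))
    (hadm : FPA.Admissible σ₂)
    (hcoord2 : σ₂ {β | β 1 = 0} = 1)
    (hcdf : ∀ s ∈ Set.Ico (0 : ℝ) 1,
      σ₂ {β | β 0 ≤ s} = ENNReal.ofReal (min 1 (t / (1 - s)))) :
    FPA.Equilibrium (tightV t) ({0} : Finset (Fin 2)) ({1} : Finset (Fin 2))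
        ![Measure.dirac ![0, 0], σ₂] ∧
    FPA.EVal (tightV t) ![Measure.dirac ![0, 0], σ₂] 0 = t ∧
    FPA.EVal (tightV t) ![Measure.dirac ![0, 0], σ₂] 1 = 1 - t + t * Real.log t ∧
    (∑ i, FPA.EVal (tightV t) ![Measure.dirac ![0, 0], σ₂] i) /
        (∑ j, Finset.univ.sup' Finset.univ_nonempty fun i => tightV t i j) =
      (1 + t * Real.log t) / (2 - t + t * Real.log t) := by
  have hw := FPA.tightV_pos ht0 ht1
  have : IsProbabilityMeasure σ₂ := hadm.1
  have h0 : ∀ᵐ β ∂σ₂, 0 ≤ β 0 := hadm.2.1.mono fun β hβ => hβ 0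
  have hm : MeasurableSet {β : Fin 2 → ℝ | β 1 = 0} :=
    measurableSet_eq_fun (by fun_prop) (by fun_prop)
  have h1 : ∀ᵐ β ∂σ₂, β 1 = 0 := (mem_ae_iff_prob_eq_one hm).2 hcoord2
  have hV0 : FPA.EVal (tightV t) ![Measure.dirac ![0, 0], σ₂] 0 = t := by
    rw [FPA.EVal_zero_eq, FPA.cdf_eq ht0 hcdf le_rfl one_pos]
    simpa using ht1.le
  have hV1 := FPA.EVal_one_eq hw h1
  refine ⟨⟨?_, ?_, ?_⟩, hV0, hV1, ?_⟩
  · refine Fin.forall_fin_two.2 ⟨FPA.admissible_dirac fun j => ?_, hadm⟩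
    fin_cases j <;> simp
  · intro i hi σ hσ
    obtain rfl := Finset.mem_singleton.1 hi
    have hu : Function.update ![Measure.dirac ![0, 0], σ₂] 0 σ = ![σ, σ₂] := by
      ext1 i; fin_cases i <;> rfl
    rw [hu]
    refine (FPA.EUtil_zero_le hσ fun s hs => FPA.one_sub_mul_cdf_le ht0 ht1 hcdf hs).trans_eq ?_
    rw [FPA.EUtil, hV0, FPA.EPay_zero_eq, sub_zero]
  · intro i hi
    obtain rfl := Finset.mem_singleton.1 hi
    refine ⟨?_, fun σ hσ _ => ?_⟩
    · rw [FPA.EPay_one_eq h0 h1, FPA.integral_bid ht0 ht1 hadm hcdf, hV1]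
    · have hu : Function.update ![Measure.dirac ![0, 0], σ₂] 1 σ =
          ![Measure.dirac ![0, 0], σ] := by
        ext1 i; fin_cases i <;> rfl
      have : IsProbabilityMeasure σ := hσ.1
      rw [hu, hV1]
      exact FPA.EVal_one_le hw
  · rw [FPA.sum_sup_tightV hw, Fin.sum_univ_two, hV0, hV1]
    congr 1
    ring
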